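/- (Completeness of hyperquasi-equational logic.) For every set Σ of quasi-identities of type τ and every quasi-identity e of type τ: e is a hyperconsequence of Σ if and only if e is derivable from Σ in the calculus HQ. In symbols: Σ ⊨_HQ e if and only if Σ ⊢_HQ e. -/

import Mathlib

open scoped Classical

/-- Terms of a type `τ = (I, ar)`: an indexed family of operation symbols `I`
with arities `ar`, over countably many variables. -/
inductive Trm (I : Type) (ar : I → ℕ) : Type
  | var : ℕ → Trm I ar
  | app (f : I) : (Fin (ar f) → Trm I ar) → Trm I ar

variable {I : Type} {ar : I → ℕ}

/-- Simultaneous substitution of terms for variables. -/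
def Trm.subst (δ : ℕ → Trm I ar) : Trm I ar → Trm I ar
  | .var n => δ n
  | .app f ts => .app f fun i => (ts i).subst δ

/-- A hypersubstitution assigns to each operation symbol `f` a term `σ(f)`. -/
def Hyp (I : Type) (ar : I → ℕ) := (f : I) → Trm I ar

/-- The extension of a hypersubstitution to all terms. -/
def Hyp.apply (σ : Hyp I ar) : Trm I ar → Trm I ar
  | .var n => .var n
  | .app f ts => (σ f).subst fun n => if h : n < ar f then σ.apply (ts ⟨n, h⟩) else .var n

/-- The identity hypersubstitution `σ_id`. -/
def Hyp.id (I : Type) (ar : I → ℕ) : Hyp I ar := fun f => .app f fun i => .var i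

/-- Composition of hypersubstitutions: `(σ₁ ∘ σ₂)(f) = σ₁(σ₂(f))`. -/
def Hyp.comp (σ₁ σ₂ : Hyp I ar) : Hyp I ar := fun f => σ₁.apply (σ₂ f)

/-- Occurrence of the variable `m` in a term. -/
inductive Occurs (m : ℕ) : Trm I ar → Prop
  | var : Occurs m (.var m)
  | app {f ts} (i : Fin (ar f)) : Occurs m (ts i) → Occurs m (.app f ts)

/-- `σ` is a genuine hypersubstitution: `σ(f)` is an `(ar f)`-ary term,
i.e. its variables are among `x₀, …, x_{ar f - 1}`.  The set `{σ | IsHyp σ}`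
plays the role of the monoid `H(τ)` of all hypersubstitutions of type `τ`. -/
def IsHyp (σ : Hyp I ar) : Prop := ∀ f m, Occurs m (σ f) → m < ar f

/-- An identity `t ≈ s` of type `τ`. -/
abbrev Eqn (I : Type) (ar : I → ℕ) := Trm I ar × Trm I ar

/-- A quasi-identity `Δ → α` of type `τ`: a finite set `Δ` of identities
(the premises) together with an identity `α` (the conclusion). -/
abbrev Quasi (I : Type) (ar : I → ℕ) := Finset (Eqn I ar) × Eqn I ar

/-- Applying a map on terms to every term occurring in a quasi-identity. -/
noncomputable def mapQ (g : Trm I ar → Trm I ar) (q : Quasi I ar) : Quasi I ar :=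
  (q.1.image fun p => (g p.1, g p.2), (g q.2.1, g q.2.2))

/-- An algebra of type `τ`. -/
structure Alg (I : Type) (ar : I → ℕ) where
  carrier : Type
  ops : (f : I) → (Fin (ar f) → carrier) → carrier

/-- Evaluation of a term in an algebra under an assignment `v`. -/
def Alg.eval (A : Alg I ar) (v : ℕ → A.carrier) : Trm I ar → A.carrier
  | .var n => v n
  | .app f ts => A.ops f fun i => A.eval v (ts i)

/-- Satisfaction of a quasi-identity in an algebra: every assignment making all
premises hold makes the conclusion hold. -/
def Alg.Sat (A : Alg I ar) (q : Quasi I ar) : Prop :=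
  ∀ v : ℕ → A.carrier,
    (∀ p ∈ q.1, A.eval v p.1 = A.eval v p.2) → A.eval v q.2.1 = A.eval v q.2.2

/-- `M`-hypersatisfaction of a quasi-identity in an algebra: `A` satisfies
`σ(q)` for every hypersubstitution `σ ∈ M`. -/
def Alg.HypSatM (A : Alg I ar) (M : Set (Hyp I ar)) (q : Quasi I ar) : Prop :=
  ∀ σ ∈ M, A.Sat (mapQ (Hyp.apply σ) q)

/-- The quasi-equational calculus `Q` (when `M = ∅`), resp. its extension by the
hypersubstitution rule for the hypersubstitutions of `M`: `MHQ` for a submonoid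
`M ⊆ H(τ)`, and `HQ` when `M = {σ | IsHyp σ} = H(τ)`. -/
inductive Der (M : Set (Hyp I ar)) (S : Set (Quasi I ar)) : Quasi I ar → Prop
  | hyp {q} : q ∈ S → Der M S q
  | refl (p : Trm I ar) : Der M S (∅, (p, p))
  | assm (α : Eqn I ar) : Der M S ({α}, α)
  | symm (p q : Trm I ar) : Der M S ({(p, q)}, (q, p))
  | trans (p q r : Trm I ar) : Der M S ({(p, q), (q, r)}, (p, r))
  | compat (f : I) (t s : Fin (ar f) → Trm I ar) :
      Der M S (Finset.univ.image fun i => (t i, s i), (.app f t, .app f s))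
  | subst {q} (δ : ℕ → Trm I ar) : Der M S q → Der M S (mapQ (Trm.subst δ) q)
  | hypsub {q} {σ : Hyp I ar} : σ ∈ M → Der M S q → Der M S (mapQ (Hyp.apply σ) q)
  | cut {Δ Γ : Finset (Eqn I ar)} {α β : Eqn I ar} :
      Der M S (Δ, α) → Der M S (insert α Γ, β) → Der M S (Δ ∪ Γ, β)
  | ext {Δ : Finset (Eqn I ar)} {α : Eqn I ar} (β : Eqn I ar) :
      Der M S (Δ, α) → Der M S (insert β Δ, α)

theorem Trm.subst_var (t : Trm I ar) : t.subst .var = t := by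
  induction t with
  | var n => rfl
  | app f ts ih => simp only [Trm.subst, ih]

theorem Trm.subst_congr {δ ε : ℕ → Trm I ar} (t : Trm I ar)
    (h : ∀ m, Occurs m t → δ m = ε m) : t.subst δ = t.subst ε := by
  induction t with
  | var n => exact h n .var
  | app f ts ih =>
    simp only [Trm.subst]
    congr 1
    funext i
    exact ih i fun m hm => h m (.app i hm)

theorem Trm.subst_subst (δ ε : ℕ → Trm I ar) (t : Trm I ar) :
    (t.subst δ).subst ε = t.subst fun n => (δ n).subst ε := by
  induction t with
  | var n => rfl
  | app f ts ih => simp only [Trm.subst, ih]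

theorem Occurs.of_subst {m : ℕ} {δ : ℕ → Trm I ar} {t : Trm I ar}
    (h : Occurs m (t.subst δ)) : ∃ n, Occurs n t ∧ Occurs m (δ n) := by
  induction t with
  | var n => exact ⟨n, .var, h⟩
  | app f ts ih =>
    cases h with
    | app i hi =>
      obtain ⟨n, hn, hm⟩ := ih i hi
      exact ⟨n, .app i hn, hm⟩

theorem Alg.eval_subst (A : Alg I ar) (v : ℕ → A.carrier) (δ : ℕ → Trm I ar) (t : Trm I ar) :
    A.eval v (t.subst δ) = A.eval (fun n => A.eval v (δ n)) t := by
  induction t with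
  | var n => rfl
  | app f ts ih => simp only [Trm.subst, Alg.eval, ih]

theorem Hyp.id_apply (t : Trm I ar) : (Hyp.id I ar).apply t = t := by
  induction t with
  | var n => rfl
  | app f ts ih => simp [Hyp.apply, Hyp.id, Trm.subst, ih]

theorem isHyp_id : IsHyp (Hyp.id I ar) := by
  intro f m h
  cases h with
  | app i hi =>
    cases hi
    exact i.isLt

/-- The extension of a genuine hypersubstitution commutes with substitution. -/
theorem IsHyp.apply_subst {σ : Hyp I ar} (hσ : IsHyp σ) (δ : ℕ → Trm I ar) (t : Trm I ar) :
    σ.apply (t.subst δ) = (σ.apply t).subst fun n => σ.apply (δ n) := by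
  induction t with
  | var n => rfl
  | app f ts ih =>
    simp only [Trm.subst, Hyp.apply, Trm.subst_subst]
    refine Trm.subst_congr _ fun m hm => ?_
    simp only [dif_pos (hσ f m hm), ih]

theorem IsHyp.occurs_of_apply {σ : Hyp I ar} (hσ : IsHyp σ) {m : ℕ} {t : Trm I ar}
    (h : Occurs m (σ.apply t)) : Occurs m t := by
  induction t with
  | var n => exact h
  | app f ts ih =>
    obtain ⟨n, hn, hm⟩ := Occurs.of_subst h
    rw [dif_pos (hσ f n hn)] at hm
    exact .app _ (ih _ hm)

theorem IsHyp.comp {σ ρ : Hyp I ar} (hσ : IsHyp σ) (hρ : IsHyp ρ) : IsHyp (σ.comp ρ) :=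
  fun f m h => hρ f m (hσ.occurs_of_apply h)

theorem IsHyp.comp_apply {σ : Hyp I ar} (hσ : IsHyp σ) (ρ : Hyp I ar) (t : Trm I ar) :
    (σ.comp ρ).apply t = σ.apply (ρ.apply t) := by
  induction t with
  | var n => rfl
  | app f ts ih =>
    simp only [Hyp.apply, hσ.apply_subst, Hyp.comp]
    congr 1
    funext n
    split_ifs with h
    · exact ih _
    · rfl

theorem Alg.sat_mapQ_iff (A : Alg I ar) (g : Trm I ar → Trm I ar) (q : Quasi I ar) :
    A.Sat (mapQ g q) ↔ ∀ v : ℕ → A.carrier,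
      (∀ p ∈ q.1, A.eval v (g p.1) = A.eval v (g p.2)) →
        A.eval v (g q.2.1) = A.eval v (g q.2.2) := by
  simp only [Alg.Sat, mapQ, Finset.forall_mem_image]

/-- Soundness of the calculus `HQ`. -/
theorem Der.sound {S : Set (Quasi I ar)} {e : Quasi I ar}
    (h : Der {σ : Hyp I ar | IsHyp σ} S e) (A : Alg I ar)
    (hA : ∀ q ∈ S, A.HypSatM {σ : Hyp I ar | IsHyp σ} q) :
    A.HypSatM {σ : Hyp I ar | IsHyp σ} e := by
  induction h with
  | hyp hq => exact hA _ hq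
  | refl p => exact fun σ _ => (A.sat_mapQ_iff _ _).2 fun v _ => rfl
  | assm α =>
    exact fun σ _ => (A.sat_mapQ_iff _ _).2 fun v hv => hv _ (Finset.mem_singleton_self _)
  | symm p q =>
    exact fun σ _ => (A.sat_mapQ_iff _ _).2 fun v hv =>
      (hv _ (Finset.mem_singleton_self (p, q))).symm
  | trans p q r =>
    exact fun σ _ => (A.sat_mapQ_iff _ _).2 fun v hv =>
      (hv (p, q) (by simp)).trans (hv (q, r) (by simp))
  | compat f t s =>
    refine fun σ _ => (A.sat_mapQ_iff _ _).2 fun v hv => ?_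
    simp only [Hyp.apply, Alg.eval_subst]
    congr 1
    funext n
    split_ifs with hn
    · exact hv (t ⟨n, hn⟩, s ⟨n, hn⟩) (Finset.mem_image_of_mem _ (Finset.mem_univ _))
    · rfl
  | subst δ _ ih =>
    intro σ hσ
    rw [A.sat_mapQ_iff]
    intro v hv
    have key := (A.sat_mapQ_iff _ _).1 (ih σ hσ) fun n => A.eval v (σ.apply (δ n))
    simp only [← Alg.eval_subst, ← IsHyp.apply_subst hσ] at key
    exact key fun p hp => hv _ (Finset.mem_image_of_mem _ hp)
  | @hypsub q ρ hρ _ ih =>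
    intro σ hσ
    rw [A.sat_mapQ_iff]
    intro v hv
    have key := (A.sat_mapQ_iff _ _).1 (ih (σ.comp ρ) (IsHyp.comp hσ hρ)) v
    simp only [IsHyp.comp_apply hσ] at key
    exact key fun p hp => hv _ (Finset.mem_image_of_mem _ hp)
  | cut _ _ ih₁ ih₂ =>
    refine fun σ hσ => (A.sat_mapQ_iff _ _).2 fun v hv =>
      (A.sat_mapQ_iff _ _).1 (ih₂ σ hσ) v fun p hp => ?_
    rcases Finset.mem_insert.1 hp with rfl | hp
    · exact (A.sat_mapQ_iff _ _).1 (ih₁ σ hσ) v fun p hp => hv p (Finset.mem_union_left _ hp)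
    · exact hv p (Finset.mem_union_right _ hp)
  | ext β _ ih =>
    exact fun σ hσ => (A.sat_mapQ_iff _ _).2 fun v hv =>
      (A.sat_mapQ_iff _ _).1 (ih σ hσ) v fun p hp => hv p (Finset.mem_insert_of_mem hp)

theorem Der.union_left {M : Set (Hyp I ar)} {S : Set (Quasi I ar)} {Δ : Finset (Eqn I ar)}
    {α : Eqn I ar} (h : Der M S (Δ, α)) (Γ : Finset (Eqn I ar)) : Der M S (Γ ∪ Δ, α) := by
  induction Γ using Finset.induction_on with
  | empty => rwa [Finset.empty_union]
  | insert a Γ _ ih =>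
    rw [Finset.insert_union]
    exact ih.ext a

theorem Der.mono {M : Set (Hyp I ar)} {S : Set (Quasi I ar)} {Δ Γ : Finset (Eqn I ar)}
    {α : Eqn I ar} (h : Der M S (Δ, α)) (hs : Δ ⊆ Γ) : Der M S (Γ, α) := by
  have := h.union_left Γ
  rwa [Finset.union_eq_left.2 hs] at this

theorem Der.of_mem {M : Set (Hyp I ar)} {S : Set (Quasi I ar)} {Δ : Finset (Eqn I ar)}
    {α : Eqn I ar} (h : α ∈ Δ) : Der M S (Δ, α) :=
  (Der.assm α).mono (Finset.singleton_subset_iff.2 h)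

/-- Simultaneous cut. -/
theorem Der.cut_all {M : Set (Hyp I ar)} {S : Set (Quasi I ar)} {Δ Γ : Finset (Eqn I ar)}
    {β : Eqn I ar} (hΓ : Der M S (Γ, β)) (hΔ : ∀ p ∈ Γ, Der M S (Δ, p)) :
    Der M S (Δ, β) := by
  have key : Der M S (Γ ∪ Δ, β) := hΓ.mono Finset.subset_union_left
  clear hΓ
  induction Γ using Finset.induction_on with
  | empty => rwa [Finset.empty_union] at key
  | insert a Γ _ ih =>
    refine ih (fun p hp => hΔ p (Finset.mem_insert_of_mem hp)) ?_
    rw [Finset.insert_union] at key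
    have h := Der.cut (hΔ a (Finset.mem_insert_self _ _)) key
    rwa [Finset.union_eq_right.2 Finset.subset_union_right] at h

/-- Provable equality of terms under the premises `Δ`. -/
def derSetoid (M : Set (Hyp I ar)) (S : Set (Quasi I ar)) (Δ : Finset (Eqn I ar)) :
    Setoid (Trm I ar) where
  r t s := Der M S (Δ, (t, s))
  iseqv :=
    { refl := fun t => (Der.refl t).mono (Finset.empty_subset _)
      symm := fun {t s} h => (Der.symm t s).cut_all (by simpa using h)
      trans := fun {t s u} h k => (Der.trans t s u).cut_all (by simpa using ⟨h, k⟩) }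

/-- The term algebra modulo provable equality under the premises `Δ`. -/
noncomputable def derAlg (M : Set (Hyp I ar)) (S : Set (Quasi I ar)) (Δ : Finset (Eqn I ar)) :
    Alg I ar where
  carrier := Quotient (derSetoid M S Δ)
  ops f xs := Quotient.mk _ (.app f fun i => (xs i).out)

theorem derAlg_eval (M : Set (Hyp I ar)) (S : Set (Quasi I ar)) (Δ : Finset (Eqn I ar))
    (δ : ℕ → Trm I ar) (t : Trm I ar) :
    (derAlg M S Δ).eval (fun n => Quotient.mk (derSetoid M S Δ) (δ n)) t =
      Quotient.mk (derSetoid M S Δ) (t.subst δ) := by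
  induction t with
  | var n => rfl
  | app f ts ih =>
    simp only [Alg.eval, ih, Trm.subst]
    refine Quotient.sound ((Der.compat f _ _).cut_all ?_)
    simp only [Finset.forall_mem_image]
    exact fun i _ => Quotient.exact (Quotient.out_eq (Quotient.mk (derSetoid M S Δ) _))

theorem derAlg_sat {M : Set (Hyp I ar)} {S : Set (Quasi I ar)} (Δ : Finset (Eqn I ar))
    {q : Quasi I ar} (h : Der M S q) : (derAlg M S Δ).Sat q := by
  intro v hv
  obtain ⟨δ, rfl⟩ : ∃ δ : ℕ → Trm I ar, v = fun n => Quotient.mk (derSetoid M S Δ) (δ n) :=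
    ⟨fun n => Quotient.out (v n), funext fun n => (Quotient.out_eq (v n)).symm⟩
  simp only [derAlg_eval] at hv ⊢
  refine Quotient.sound ((h.subst δ).cut_all ?_)
  simp only [Finset.forall_mem_image]
  exact fun p hp => Quotient.exact (hv p hp)

theorem Der.of_derAlg_sat {M : Set (Hyp I ar)} {S : Set (Quasi I ar)} {e : Quasi I ar}
    (h : (derAlg M S e.1).Sat e) : Der M S e := by
  have key := h fun n => Quotient.mk (derSetoid M S e.1) (.var n)
  simp only [derAlg_eval, Trm.subst_var] at key
  exact Quotient.exact (key fun p hp => Quotient.sound (Der.of_mem hp))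

/-- Completeness of hyperquasi-equational logic: a quasi-identity `e` is a
hyperconsequence of a set `Σ` of quasi-identities (every algebra of type `τ`
hypersatisfying every member of `Σ` hypersatisfies `e`) if and only if `e` is
derivable from `Σ` in the calculus `HQ`:  `Σ ⊨_HQ e ↔ Σ ⊢_HQ e`. -/
theorem completeness_HQ (S : Set (Quasi I ar)) (e : Quasi I ar) :
    (∀ A : Alg I ar, (∀ q ∈ S, A.HypSatM {σ : Hyp I ar | IsHyp σ} q) →
        A.HypSatM {σ : Hyp I ar | IsHyp σ} e) ↔
      Der {σ : Hyp I ar | IsHyp σ} S e := by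
  refine ⟨fun h => Der.of_derAlg_sat ?_, fun h A hA => h.sound A hA⟩
  have key := h (derAlg _ S e.1) (fun q hq σ hσ => derAlg_sat _ (.hypsub hσ (.hyp hq)))
    (Hyp.id I ar) isHyp_id
  simp only [Alg.sat_mapQ_iff, Hyp.id_apply] at key
  exact key
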